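/- Let f : ℝ × ℝ → ℝ be C^∞ and let u be a C^∞ solution of u'(t) = f(t, u(t)) on [a,b]. Fix t ∈ [a,b), write f, f_t, f_u, f_tt, f_tu, f_uu for f and its partial derivatives evaluated at (t, u(t)) and write v = u(t). Take the three-stage IMQ-RBF Runge–Kutta method with a₂₁ = c₂ = 1/3, a₃₁ = −5/12, a₃₂ = 5/4, c₃ = 5/6, b₁ = 1/10, b₂ = 1/2, b₃ = 2/5, and shape parameters ε₂² = (−f·f_t·f_uu + 3f·f_u³ + f·f_u·f_tu + 3f_t·f_u² − f_t·f_tu + f_tt·f_u)/(v·f·f_uu − 2v·f_u² + v·f_tu − f·f_u) and ε₃² = −ε₂²/5, assuming the denominator v·f·f_uu − 2v·f_u² + v·f_tu − f·f_u is nonzero. Then the local truncation error τ(t,h) satisfies τ(t,h) = O(h⁴) as h → 0⁺; that is, there exist C > 0 and h₀ > 0 such that |τ(t,h)| ≤ C h⁴ for all 0 < h ≤ h₀ (so the method is fourth-order accurate). -/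

import Mathlib

/-- Directional (partial) derivative of `f : ℝ × ℝ → ℝ` in the direction `d`;
`pd f (1,0) = f_t`, `pd f (0,1) = f_u`, and iterates give higher partials. -/
noncomputable def pd (f : ℝ × ℝ → ℝ) (d : ℝ × ℝ) : ℝ × ℝ → ℝ :=
  fun p => fderiv ℝ f p d

open Filter Topology Asymptotics Set

lemma contDiff_pd {f : ℝ × ℝ → ℝ} (hf : ContDiff ℝ (⊤ : ℕ∞) f) (d : ℝ × ℝ) :
    ContDiff ℝ (⊤ : ℕ∞) (pd f d) :=
  (hf.fderiv_right (m := (⊤ : ℕ∞)) (by simp)).clm_apply contDiff_const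

lemma hasFDerivAt_pd {f : ℝ × ℝ → ℝ} (hf : ContDiff ℝ (⊤ : ℕ∞) f) (p : ℝ × ℝ) :
    HasFDerivAt f (pd f (1, 0) p • ContinuousLinearMap.fst ℝ ℝ ℝ +
      pd f (0, 1) p • ContinuousLinearMap.snd ℝ ℝ ℝ) p := by
  have h := (hf.differentiable (by simp) p).hasFDerivAt
  refine h.congr_fderiv ?_
  ext <;> simp [pd]

lemma pd_comm {f : ℝ × ℝ → ℝ} (hf : ContDiff ℝ (⊤ : ℕ∞) f) (d e : ℝ × ℝ) :
    pd (pd f d) e = pd (pd f e) d := by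
  have h2 : Differentiable ℝ (fderiv ℝ f) :=
    (hf.fderiv_right (m := (⊤ : ℕ∞)) (by simp)).differentiable (by simp)
  have key : ∀ d e p, pd (pd f d) e p = fderiv ℝ (fderiv ℝ f) p e d := by
    intro d e p
    have := ((h2 p).hasFDerivAt.clm_apply (hasFDerivAt_const d p)).fderiv
    change fderiv ℝ (fun y => fderiv ℝ f y d) p e = _
    rw [this]
    simp
  funext p
  rw [key, key]
  have hs : IsSymmSndFDerivAt ℝ f p :=
    hf.contDiffAt.isSymmSndFDerivAt (by
      rw [minSmoothness_of_isRCLikeNormedField]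
      exact WithTop.coe_le_coe.2 (le_top (a := (2 : ℕ∞))))
  exact hs _ _

lemma isBigO_pow_succ_of_hasFDerivAt {E : Type*} [NormedAddCommGroup E] [NormedSpace ℝ E]
    {g : E → ℝ} {g' : E → E →L[ℝ] ℝ} {p₀ : E} {n : ℕ}
    (hg : ∀ p, HasFDerivAt g (g' p) p) (h0 : g p₀ = 0)
    (hO : g' =O[𝓝 p₀] fun p => ‖p - p₀‖ ^ n) :
    g =O[𝓝 p₀] fun p => ‖p - p₀‖ ^ (n + 1) := by
  obtain ⟨C, hC, hCO⟩ := hO.exists_pos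
  obtain ⟨r, hr, hball⟩ := Metric.eventually_nhds_iff_ball.1 hCO.bound
  refine IsBigO.of_bound C ?_
  filter_upwards [Metric.ball_mem_nhds p₀ hr] with p hp
  have hC0 : ∀ q ∈ Metric.closedBall p₀ ‖p - p₀‖, ‖g' q‖ ≤ C * ‖p - p₀‖ ^ n := by
    intro q hq
    rw [Metric.mem_closedBall, dist_eq_norm] at hq
    rw [Metric.mem_ball, dist_eq_norm] at hp
    have := hball q (by rw [Metric.mem_ball, dist_eq_norm]; linarith)
    rw [norm_pow, norm_norm] at this
    calc ‖g' q‖ ≤ C * ‖q - p₀‖ ^ n := this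
      _ ≤ C * ‖p - p₀‖ ^ n := by gcongr
  have := (convex_closedBall p₀ ‖p - p₀‖).norm_image_sub_le_of_norm_hasFDerivWithin_le
    (fun q _ => (hg q).hasFDerivWithinAt) hC0
    (by simp : p₀ ∈ Metric.closedBall p₀ ‖p - p₀‖)
    (by simp [dist_eq_norm] : p ∈ Metric.closedBall p₀ ‖p - p₀‖)
  rw [h0, sub_zero] at this
  rw [norm_pow, norm_norm]
  calc _ ≤ _ := this
    _ = _ := by ring

lemma isBigO_pow_succ_of_partials {g A B : ℝ × ℝ → ℝ} {p₀ : ℝ × ℝ} {n : ℕ}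
    (hg : ∀ p, HasFDerivAt g (A p • ContinuousLinearMap.fst ℝ ℝ ℝ +
      B p • ContinuousLinearMap.snd ℝ ℝ ℝ) p) (h0 : g p₀ = 0)
    (hA : A =O[𝓝 p₀] fun p => ‖p - p₀‖ ^ n) (hB : B =O[𝓝 p₀] fun p => ‖p - p₀‖ ^ n) :
    g =O[𝓝 p₀] fun p => ‖p - p₀‖ ^ (n + 1) := by
  refine isBigO_pow_succ_of_hasFDerivAt hg h0 (IsBigO.add ?_ ?_)
  · simpa using hA.smul (isBigO_const_const (ContinuousLinearMap.fst ℝ ℝ ℝ)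
      (one_ne_zero (α := ℝ)) (𝓝 p₀))
  · simpa using hB.smul (isBigO_const_const (ContinuousLinearMap.snd ℝ ℝ ℝ)
      (one_ne_zero (α := ℝ)) (𝓝 p₀))

lemma taylor_linear {f : ℝ × ℝ → ℝ} (hf : ContDiff ℝ (⊤ : ℕ∞) f) (p₀ : ℝ × ℝ) :
    (fun p => f p - (f p₀ + pd f (1, 0) p₀ * (p.1 - p₀.1) + pd f (0, 1) p₀ * (p.2 - p₀.2)))
      =O[𝓝 p₀] fun p => ‖p - p₀‖ ^ 2 := by
  have key : ∀ d, (fun p => pd f d p - pd f d p₀) =O[𝓝 p₀] fun p => ‖p - p₀‖ ^ 1 := by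
    intro d
    have := ((contDiff_pd hf d).differentiable (by simp) p₀).hasFDerivAt.isBigO_sub
    simpa using this.norm_right
  refine isBigO_pow_succ_of_partials (fun p => ?_) (by simp) (key (1, 0)) (key (0, 1))
  have hx := (hasFDerivAt_fst (𝕜 := ℝ) (p := p)).sub_const p₀.1
  have hy := (hasFDerivAt_snd (𝕜 := ℝ) (p := p)).sub_const p₀.2
  refine ((hasFDerivAt_pd hf p).sub (((hx.const_mul (pd f (1, 0) p₀)).const_add (f p₀)).add
    (hy.const_mul (pd f (0, 1) p₀)))).congr_fderiv ?_
  ext <;> simp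

lemma taylor_quadratic {f : ℝ × ℝ → ℝ} (hf : ContDiff ℝ (⊤ : ℕ∞) f) (p₀ : ℝ × ℝ) :
    (fun p => f p - (f p₀ + pd f (1, 0) p₀ * (p.1 - p₀.1) + pd f (0, 1) p₀ * (p.2 - p₀.2) +
      pd (pd f (1, 0)) (1, 0) p₀ / 2 * (p.1 - p₀.1) ^ 2 +
      pd (pd f (1, 0)) (0, 1) p₀ * ((p.1 - p₀.1) * (p.2 - p₀.2)) +
      pd (pd f (0, 1)) (0, 1) p₀ / 2 * (p.2 - p₀.2) ^ 2))
      =O[𝓝 p₀] fun p => ‖p - p₀‖ ^ 3 := by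
  refine isBigO_pow_succ_of_partials (fun p => ?_) (by simp)
    (taylor_linear (contDiff_pd hf (1, 0)) p₀) (taylor_linear (contDiff_pd hf (0, 1)) p₀)
  have hx := (hasFDerivAt_fst (𝕜 := ℝ) (p := p)).sub_const p₀.1
  have hy := (hasFDerivAt_snd (𝕜 := ℝ) (p := p)).sub_const p₀.2
  refine ((hasFDerivAt_pd hf p).sub (((((hx.const_mul (pd f (1, 0) p₀)).const_add (f p₀)).add
    (hy.const_mul (pd f (0, 1) p₀))).add
    ((hx.pow 2).const_mul (pd (pd f (1, 0)) (1, 0) p₀ / 2))).add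
    ((hx.mul hy).const_mul (pd (pd f (1, 0)) (0, 1) p₀)) |>.add
    ((hy.pow 2).const_mul (pd (pd f (0, 1)) (0, 1) p₀ / 2)))).congr_fderiv ?_
  rw [pd_comm hf (0, 1) (1, 0)]
  ext <;> simp <;> ring

lemma taylor_cubic {f : ℝ × ℝ → ℝ} (hf : ContDiff ℝ (⊤ : ℕ∞) f) (p₀ : ℝ × ℝ) :
    ∃ c₁ c₂ c₃ c₄ : ℝ,
    (fun p => f p - (f p₀ + pd f (1, 0) p₀ * (p.1 - p₀.1) + pd f (0, 1) p₀ * (p.2 - p₀.2) +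
      pd (pd f (1, 0)) (1, 0) p₀ / 2 * (p.1 - p₀.1) ^ 2 +
      pd (pd f (1, 0)) (0, 1) p₀ * ((p.1 - p₀.1) * (p.2 - p₀.2)) +
      pd (pd f (0, 1)) (0, 1) p₀ / 2 * (p.2 - p₀.2) ^ 2 +
      c₁ * (p.1 - p₀.1) ^ 3 + c₂ * ((p.1 - p₀.1) ^ 2 * (p.2 - p₀.2)) +
      c₃ * ((p.1 - p₀.1) * (p.2 - p₀.2) ^ 2) + c₄ * (p.2 - p₀.2) ^ 3))
      =O[𝓝 p₀] fun p => ‖p - p₀‖ ^ 4 := by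
  refine ⟨pd (pd (pd f (1, 0)) (1, 0)) (1, 0) p₀ / 6, pd (pd (pd f (1, 0)) (1, 0)) (0, 1) p₀ / 2,
    pd (pd (pd f (1, 0)) (0, 1)) (0, 1) p₀ / 2, pd (pd (pd f (0, 1)) (0, 1)) (0, 1) p₀ / 6, ?_⟩
  refine isBigO_pow_succ_of_partials (fun p => ?_) (by simp)
    (taylor_quadratic (contDiff_pd hf (1, 0)) p₀) (taylor_quadratic (contDiff_pd hf (0, 1)) p₀)
  have hx := (hasFDerivAt_fst (𝕜 := ℝ) (p := p)).sub_const p₀.1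
  have hy := (hasFDerivAt_snd (𝕜 := ℝ) (p := p)).sub_const p₀.2
  refine ((hasFDerivAt_pd hf p).sub (((((hx.const_mul (pd f (1, 0) p₀)).const_add (f p₀)).add
    (hy.const_mul (pd f (0, 1) p₀))).add
    ((hx.pow 2).const_mul (pd (pd f (1, 0)) (1, 0) p₀ / 2))).add
    ((hx.mul hy).const_mul (pd (pd f (1, 0)) (0, 1) p₀)) |>.add
    ((hy.pow 2).const_mul (pd (pd f (0, 1)) (0, 1) p₀ / 2)) |>.add
    ((hx.pow 3).const_mul _) |>.add (((hx.pow 2).mul hy).const_mul _) |>.add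
    ((hx.mul (hy.pow 2)).const_mul _) |>.add ((hy.pow 3).const_mul _))).congr_fderiv ?_
  rw [pd_comm hf (0, 1) (1, 0), pd_comm (contDiff_pd hf (1, 0)) (0, 1) (1, 0)]
  ext <;> simp <;> ring

lemma isBigO_one_of_continuous {g : ℝ → ℝ} (hg : Continuous g) :
    g =O[𝓝[>] 0] fun _ => (1 : ℝ) :=
  ((hg.tendsto 0).mono_left nhdsWithin_le_nhds).isBigO_one ℝ

lemma isBigO_pow_mul_of_continuous {g : ℝ → ℝ} (hg : Continuous g) (n : ℕ) :
    (fun h => h ^ n * g h) =O[𝓝[>] 0] fun h : ℝ => h ^ n := by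
  simpa using (isBigO_refl (fun h : ℝ => h ^ n) (𝓝[>] 0)).mul (isBigO_one_of_continuous hg)

lemma isBigO_pow_of_le {m n : ℕ} (h : n ≤ m) :
    (fun x : ℝ => x ^ m) =O[𝓝[>] 0] fun x : ℝ => x ^ n :=
  (isBigO_pow_mul_of_continuous (g := fun x : ℝ => x ^ (m - n)) (by fun_prop) n).congr_left
    fun x => by rw [← pow_add, Nat.add_sub_cancel' h]

lemma isBigO_comp_expansion {f : ℝ × ℝ → ℝ} {t v F ft fu ftt ftu fuu c₁ c₂ c₃ c₄ : ℝ}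
    (hT : (fun p : ℝ × ℝ => f p - (F + ft * (p.1 - t) + fu * (p.2 - v) +
      ftt / 2 * (p.1 - t) ^ 2 + ftu * ((p.1 - t) * (p.2 - v)) + fuu / 2 * (p.2 - v) ^ 2 +
      c₁ * (p.1 - t) ^ 3 + c₂ * ((p.1 - t) ^ 2 * (p.2 - v)) +
      c₃ * ((p.1 - t) * (p.2 - v) ^ 2) + c₄ * (p.2 - v) ^ 3))
      =O[𝓝 (t, v)] fun p => ‖p - (t, v)‖ ^ 4)
    (c : ℝ) {z : ℝ → ℝ} {y₁ y₂ y₃ : ℝ} {n : ℕ} (hn : 1 ≤ n) (hn4 : n ≤ 4)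
    (hz : (fun h => z h - (v + y₁ * h + y₂ * h ^ 2 + y₃ * h ^ 3)) =O[𝓝[>] 0] fun h : ℝ => h ^ n) :
    (fun h => f (t + c * h, z h) - (F + (ft * c + fu * y₁) * h +
      (fu * y₂ + ftt / 2 * c ^ 2 + ftu * (c * y₁) + fuu / 2 * y₁ ^ 2) * h ^ 2 +
      (fu * y₃ + ftu * (c * y₂) + fuu * (y₁ * y₂) + c₁ * c ^ 3 + c₂ * (c ^ 2 * y₁) +
        c₃ * (c * y₁ ^ 2) + c₄ * y₁ ^ 3) * h ^ 3)) =O[𝓝[>] 0] fun h : ℝ => h ^ n := by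
  have hid : Tendsto (fun h : ℝ => h) (𝓝[>] 0) (𝓝 0) := nhdsWithin_le_nhds
  have hzO : (fun h => z h - v) =O[𝓝[>] 0] fun h : ℝ => h := by
    have h1 : (fun h => z h - (v + y₁ * h + y₂ * h ^ 2 + y₃ * h ^ 3))
        =O[𝓝[>] 0] fun h : ℝ => h ^ 1 := hz.trans (isBigO_pow_of_le hn)
    have h2 : (fun h : ℝ => h ^ 1 * (y₁ + y₂ * h + y₃ * h ^ 2)) =O[𝓝[>] 0] fun h : ℝ => h ^ 1 :=
      isBigO_pow_mul_of_continuous (by fun_prop) 1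
    refine ((h1.add h2).congr_left fun h => ?_).trans (by simpa using isBigO_refl _ _)
    ring
  have hzv : Tendsto (fun h => z h - v) (𝓝[>] 0) (𝓝 0) := hzO.trans_tendsto hid
  have hzt : Tendsto z (𝓝[>] 0) (𝓝 v) := by simpa using hzv.add_const v
  have hct : Tendsto (fun h : ℝ => t + c * h) (𝓝[>] 0) (𝓝 t) := by
    simpa using (hid.const_mul c).const_add t
  have hnorm : (fun h => ‖((t + c * h, z h) : ℝ × ℝ) - (t, v)‖) =O[𝓝[>] 0] fun h : ℝ => h := by
    refine IsBigO.norm_left ?_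
    have : (fun h : ℝ => c * h) =O[𝓝[>] 0] fun h : ℝ => h := isBigO_const_mul_self _ _ _
    simpa using this.prod_left hzO
  have hA := (hT.comp_tendsto (hct.prodMk_nhds hzt)).trans (hnorm.pow 4)
    |>.trans (isBigO_pow_of_le hn4)
  have hS : (fun h : ℝ => fu + ftu * (c * h) +
      fuu / 2 * ((z h - v) + (y₁ * h + y₂ * h ^ 2 + y₃ * h ^ 3)) + c₂ * (c * h) ^ 2 +
      c₃ * (c * h) * ((z h - v) + (y₁ * h + y₂ * h ^ 2 + y₃ * h ^ 3)) +
      c₄ * ((z h - v) ^ 2 + (z h - v) * (y₁ * h + y₂ * h ^ 2 + y₃ * h ^ 3) +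
        (y₁ * h + y₂ * h ^ 2 + y₃ * h ^ 3) ^ 2)) =O[𝓝[>] 0] fun _ => (1 : ℝ) := by
    have hpair : Tendsto (fun h : ℝ => (h, z h - v)) (𝓝[>] 0) (𝓝 (0, 0)) := hid.prodMk_nhds hzv
    have hcont : Continuous fun q : ℝ × ℝ => fu + ftu * (c * q.1) +
        fuu / 2 * (q.2 + (y₁ * q.1 + y₂ * q.1 ^ 2 + y₃ * q.1 ^ 3)) + c₂ * (c * q.1) ^ 2 +
        c₃ * (c * q.1) * (q.2 + (y₁ * q.1 + y₂ * q.1 ^ 2 + y₃ * q.1 ^ 3)) +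
        c₄ * (q.2 ^ 2 + q.2 * (y₁ * q.1 + y₂ * q.1 ^ 2 + y₃ * q.1 ^ 3) +
          (y₁ * q.1 + y₂ * q.1 ^ 2 + y₃ * q.1 ^ 3) ^ 2) := by fun_prop
    exact ((hcont.tendsto (0, 0)).comp hpair).isBigO_one ℝ
  have hB := hz.mul hS
  have hC : (fun h : ℝ => h ^ 4 * (ftu * c * y₃ +
      fuu / 2 * (y₂ ^ 2 + 2 * y₁ * y₃ + 2 * y₂ * y₃ * h + y₃ ^ 2 * h ^ 2) +
      (y₂ + y₃ * h) * (c₂ * c ^ 2 + c₃ * c * (2 * y₁ + y₂ * h + y₃ * h ^ 2) +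
        c₄ * ((y₁ + y₂ * h + y₃ * h ^ 2) ^ 2 + (y₁ + y₂ * h + y₃ * h ^ 2) * y₁ + y₁ ^ 2))))
      =O[𝓝[>] 0] fun h : ℝ => h ^ n :=
    (isBigO_pow_mul_of_continuous (by fun_prop) 4).trans (isBigO_pow_of_le hn4)
  simp only [mul_one] at hB
  refine ((hA.add hB).add hC).congr_left fun h => ?_
  simp only [Function.comp]
  ring

lemma isBigO_pow_succ_of_hasDerivWithinAt {g g' : ℝ → ℝ} {δ : ℝ} (hδ : 0 < δ) {n : ℕ}
    (hd : ∀ s ∈ Icc 0 δ, HasDerivWithinAt g (g' s) (Icc 0 δ) s) (h0 : g 0 = 0) (h0' : g' 0 = 0)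
    (hO : g' =O[𝓝[>] 0] fun h : ℝ => h ^ n) :
    g =O[𝓝[>] 0] fun h : ℝ => h ^ (n + 1) := by
  obtain ⟨C, hC, hCO⟩ := hO.exists_pos
  obtain ⟨r, hr, hball⟩ := mem_nhdsGT_iff_exists_Ioo_subset.1 hCO.bound
  rw [mem_Ioi] at hr
  refine IsBigO.of_bound C ?_
  filter_upwards [Ioo_mem_nhdsGT (lt_min hδ hr)] with h hh
  obtain ⟨hpos, hlt⟩ := hh
  rw [lt_min_iff] at hlt
  have hsub : Icc 0 h ⊆ Icc 0 δ := Icc_subset_Icc_right hlt.1.le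
  have hbound : ∀ s ∈ Icc 0 h, ‖g' s‖ ≤ C * h ^ n := by
    intro s hs
    rcases hs.1.eq_or_lt with rfl | hs0
    · rw [h0', norm_zero]; positivity
    · have : ‖g' s‖ ≤ C * ‖s ^ n‖ := hball ⟨hs0, hs.2.trans_lt hlt.2⟩
      rw [norm_pow, Real.norm_of_nonneg hs.1] at this
      exact this.trans (by gcongr; exact hs.2)
  have := (convex_Icc 0 h).norm_image_sub_le_of_norm_hasDerivWithin_le
    (fun s hs => (hd s (hsub hs)).mono hsub) hbound
    (left_mem_Icc.2 hpos.le) (right_mem_Icc.2 hpos.le)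
  rw [h0, sub_zero, sub_zero, Real.norm_of_nonneg hpos.le] at this
  rw [norm_pow, Real.norm_of_nonneg hpos.le]
  calc _ ≤ _ := this
    _ = _ := by ring

lemma isBigO_expansion_of_hasDerivWithinAt {y w : ℝ → ℝ} {δ v w₁ w₂ w₃ w₄ : ℝ}
    (hδ : 0 < δ) {n : ℕ}
    (hd : ∀ s ∈ Icc 0 δ, HasDerivWithinAt y (w s) (Icc 0 δ) s) (hy0 : y 0 = v) (hw0 : w 0 = w₁)
    (hw : (fun h => w h - (w₁ + w₂ * h + w₃ * h ^ 2 + w₄ * h ^ 3)) =O[𝓝[>] 0] fun h : ℝ => h ^ n) :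
    (fun h => y h - (v + w₁ * h + w₂ / 2 * h ^ 2 + w₃ / 3 * h ^ 3 + w₄ / 4 * h ^ 4))
      =O[𝓝[>] 0] fun h : ℝ => h ^ (n + 1) := by
  refine isBigO_pow_succ_of_hasDerivWithinAt hδ (fun s hs => ?_) (by simp [hy0]) (by simp [hw0]) hw
  have hid := hasDerivWithinAt_id s (Icc 0 δ)
  refine ((hd s hs).sub (((((hid.const_mul w₁).const_add v).add ((hid.pow 2).const_mul (w₂ / 2))).add
    ((hid.pow 3).const_mul (w₃ / 3))).add ((hid.pow 4).const_mul (w₄ / 4)))).congr_deriv ?_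
  simp
  ring

lemma eventually_sqrt (e : ℝ) : ∀ᶠ h : ℝ in 𝓝[>] 0, 0 < Real.sqrt (1 + e * h ^ 2) ∧
    Real.sqrt (1 + e * h ^ 2) ^ 2 = 1 + e * h ^ 2 := by
  have hc : Continuous fun h : ℝ => 1 + e * h ^ 2 := by fun_prop
  have : ∀ᶠ h : ℝ in 𝓝 0, 0 < 1 + e * h ^ 2 :=
    (hc.tendsto 0).eventually (lt_mem_nhds (by simp))
  filter_upwards [nhdsWithin_le_nhds this] with h hh
  exact ⟨Real.sqrt_pos.2 hh, Real.sq_sqrt hh.le⟩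

lemma isBigO_sqrt_sub_one (e : ℝ) :
    (fun h => Real.sqrt (1 + e * h ^ 2) - 1) =O[𝓝[>] 0] fun h : ℝ => h ^ 2 := by
  refine IsBigO.of_bound |e| ?_
  filter_upwards [eventually_sqrt e] with h hh
  obtain ⟨hs, hsq⟩ := hh
  set s := Real.sqrt (1 + e * h ^ 2)
  have : |s - 1| * (s + 1) = |e| * h ^ 2 := by
    rw [← abs_of_pos (by linarith : 0 < s + 1), ← abs_mul, ← abs_of_nonneg (sq_nonneg h),
      ← abs_mul]
    congr 1
    linear_combination hsq
  rw [Real.norm_eq_abs, Real.norm_of_nonneg (sq_nonneg h), ← this]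
  nlinarith [abs_nonneg (s - 1)]

lemma isBigO_sqrt_expansion (e : ℝ) :
    (fun h => Real.sqrt (1 + e * h ^ 2) - (1 + e / 2 * h ^ 2)) =O[𝓝[>] 0] fun h : ℝ => h ^ 4 := by
  have h1 := ((isBigO_sqrt_sub_one e).pow 2).const_mul_left (-1 / 2)
  refine h1.congr' ?_ (Eventually.of_forall fun h => by ring)
  filter_upwards [eventually_sqrt e] with h hh
  linear_combination (-1 / 2) * hh.2

lemma isBigO_inv_sqrt_expansion (e : ℝ) :
    (fun h => (Real.sqrt (1 + e * h ^ 2))⁻¹ - (1 - e / 2 * h ^ 2))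
      =O[𝓝[>] 0] fun h : ℝ => h ^ 4 := by
  have hc : ContinuousAt (fun h : ℝ => (Real.sqrt (1 + e * h ^ 2) + 2) *
      (Real.sqrt (1 + e * h ^ 2))⁻¹ / 2) 0 := by
    have : ContinuousAt (fun h : ℝ => Real.sqrt (1 + e * h ^ 2)) 0 := by fun_prop
    exact ((this.add continuousAt_const).mul (this.inv₀ (by simp))).div_const 2
  have hb := (hc.tendsto.mono_left (nhdsWithin_le_nhds (s := Ioi 0))).isBigO_one ℝ
  refine (((isBigO_sqrt_sub_one e).pow 2).mul hb).congr' ?_ (Eventually.of_forall fun h => by ring)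
  filter_upwards [eventually_sqrt e] with h hh
  obtain ⟨hs, hsq⟩ := hh
  have he : e * h ^ 2 = Real.sqrt (1 + e * h ^ 2) ^ 2 - 1 := by linarith
  set s := Real.sqrt (1 + e * h ^ 2)
  have : 1 - e / 2 * h ^ 2 = 1 - (s ^ 2 - 1) / 2 := by linear_combination (-1 / 2) * he
  rw [this]
  field_simp
  ring

lemma isBigO_stage_expansion {k : ℝ → ℝ} {κ₀ κ₁ κ₂ : ℝ} (e v : ℝ)
    (hk : (fun h => k h - (κ₀ + κ₁ * h + κ₂ * h ^ 2)) =O[𝓝[>] 0] fun h : ℝ => h ^ 3) :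
    (fun h => (Real.sqrt (1 + e * h ^ 2) * (h * k h) + v / Real.sqrt (1 + e * h ^ 2)) -
      (v + κ₀ * h + (κ₁ - e / 2 * v) * h ^ 2 + (κ₂ + e / 2 * κ₀) * h ^ 3))
      =O[𝓝[>] 0] fun h : ℝ => h ^ 4 := by
  have hk1 : k =O[𝓝[>] 0] fun _ => (1 : ℝ) := by
    have h1 := hk.trans (isBigO_pow_of_le (Nat.zero_le 3))
    simp only [pow_zero] at h1
    have h2 : (fun h : ℝ => κ₀ + κ₁ * h + κ₂ * h ^ 2) =O[𝓝[>] 0] fun _ => (1 : ℝ) :=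
      isBigO_one_of_continuous (by fun_prop)
    simpa using h1.add h2
  have hA := (isBigO_sqrt_expansion e).mul ((isBigO_one_of_continuous continuous_id).mul hk1)
  have hB := (isBigO_pow_mul_of_continuous (g := fun h : ℝ => 1 + e / 2 * h ^ 2)
    (by fun_prop) 1).mul hk
  have hC := (isBigO_inv_sqrt_expansion e).const_mul_left v
  have hD := isBigO_pow_mul_of_continuous (g := fun h : ℝ => e / 2 * κ₁ + e / 2 * κ₂ * h)
    (by fun_prop) 4
  simp only [mul_one] at hA
  refine (((hA.add (hB.congr_right fun h => by ring)).add hC).add hD).congr_left fun h => ?_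
  simp only [id]
  ring

lemma isBigO_solution_expansion {f : ℝ × ℝ → ℝ} {t v ft fu ftt ftu fuu c₁ c₂ c₃ c₄ δ : ℝ}
    (hT : (fun p : ℝ × ℝ => f p - (f (t, v) + ft * (p.1 - t) + fu * (p.2 - v) +
      ftt / 2 * (p.1 - t) ^ 2 + ftu * ((p.1 - t) * (p.2 - v)) + fuu / 2 * (p.2 - v) ^ 2 +
      c₁ * (p.1 - t) ^ 3 + c₂ * ((p.1 - t) ^ 2 * (p.2 - v)) +
      c₃ * ((p.1 - t) * (p.2 - v) ^ 2) + c₄ * (p.2 - v) ^ 3))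
      =O[𝓝 (t, v)] fun p => ‖p - (t, v)‖ ^ 4) (hδ : 0 < δ) {z : ℝ → ℝ} (hz0 : z 0 = v)
    (hz : ∀ s ∈ Icc 0 δ, HasDerivWithinAt z (f (t + 1 * s, z s)) (Icc 0 δ) s)
    {y₁ y₂ y₃ y₄ : ℝ} (h₁ : y₁ = f (t, v)) (h₂ : y₂ = (ft * 1 + fu * y₁) / 2)
    (h₃ : y₃ = (fu * y₂ + ftt / 2 * 1 ^ 2 + ftu * (1 * y₁) + fuu / 2 * y₁ ^ 2) / 3)
    (h₄ : y₄ = (fu * y₃ + ftu * (1 * y₂) + fuu * (y₁ * y₂) + c₁ * 1 ^ 3 + c₂ * (1 ^ 2 * y₁) +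
        c₃ * (1 * y₁ ^ 2) + c₄ * y₁ ^ 3) / 4) :
    (fun h => z h - (v + y₁ * h + y₂ * h ^ 2 + y₃ * h ^ 3 + y₄ * h ^ 4))
      =O[𝓝[>] 0] fun h : ℝ => h ^ 5 := by
  have step : ∀ n, 1 ≤ n → n ≤ 4 →
      (fun h => z h - (v + y₁ * h + y₂ * h ^ 2 + y₃ * h ^ 3)) =O[𝓝[>] 0] (fun h : ℝ => h ^ n) →
      (fun h => z h - (v + y₁ * h + y₂ * h ^ 2 + y₃ * h ^ 3 + y₄ * h ^ 4))
        =O[𝓝[>] 0] fun h : ℝ => h ^ (n + 1) := by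
    intro n hn hn4 h
    have := isBigO_expansion_of_hasDerivWithinAt hδ hz hz0 (by simp [hz0])
      (isBigO_comp_expansion hT 1 hn hn4 h)
    rwa [← h₂, ← h₃, ← h₄, ← h₁] at this
  have drop : ∀ n, n ≤ 4 →
      (fun h => z h - (v + y₁ * h + y₂ * h ^ 2 + y₃ * h ^ 3 + y₄ * h ^ 4))
        =O[𝓝[>] 0] (fun h : ℝ => h ^ n) →
      (fun h => z h - (v + y₁ * h + y₂ * h ^ 2 + y₃ * h ^ 3)) =O[𝓝[>] 0] fun h : ℝ => h ^ n := by
    intro n hn4 h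
    have h4 : (fun h : ℝ => y₄ * h ^ 4) =O[𝓝[>] 0] fun h : ℝ => h ^ n :=
      (isBigO_pow_of_le hn4).const_mul_left y₄
    refine (h.add h4).congr_left fun h => ?_
    ring
  have base : (fun h => z h - (v + y₁ * h + y₂ * h ^ 2 + y₃ * h ^ 3))
      =O[𝓝[>] 0] fun h : ℝ => h ^ 1 := by
    have hd := ((hz 0 (left_mem_Icc.2 hδ.le)).mono Ioc_subset_Icc_self).hasFDerivWithinAt.isBigO_sub
    rw [nhdsWithin_Ioc_eq_nhdsGT hδ] at hd
    have h2 := (isBigO_pow_mul_of_continuous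
      (g := fun h : ℝ => y₁ + y₂ * h + y₃ * h ^ 2) (by fun_prop) 1)
    refine (IsBigO.sub (hd.congr_right fun h => by ring) h2).congr_left fun h => ?_
    rw [hz0]
    ring
  exact step 4 (by norm_num) le_rfl (drop 4 le_rfl (step 3 (by norm_num) (by norm_num)
    (drop 3 (by norm_num) (step 2 (by norm_num) (by norm_num)
    (drop 2 (by norm_num) (step 1 le_rfl (by norm_num) base))))))

lemma isBigO_drop_cubic {k : ℝ → ℝ} {κ₀ κ₁ κ₂ κ₃ : ℝ}
    (hk : (fun h => k h - (κ₀ + κ₁ * h + κ₂ * h ^ 2 + κ₃ * h ^ 3))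
      =O[𝓝[>] 0] fun h : ℝ => h ^ 4) :
    (fun h => k h - (κ₀ + κ₁ * h + κ₂ * h ^ 2)) =O[𝓝[>] 0] fun h : ℝ => h ^ 3 :=
  ((hk.trans (isBigO_pow_of_le (by norm_num))).add
    ((isBigO_refl (fun h : ℝ => h ^ 3) _).const_mul_left κ₃)).congr_left fun h => by ring

lemma isBigO_affine_expansion {k : ℝ → ℝ} {κ₀ κ₁ κ₂ : ℝ} (p q : ℝ)
    (hk : (fun h => k h - (κ₀ + κ₁ * h + κ₂ * h ^ 2)) =O[𝓝[>] 0] fun h : ℝ => h ^ 3) :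
    (fun h => (p + q * k h) - ((p + q * κ₀) + q * κ₁ * h + q * κ₂ * h ^ 2))
      =O[𝓝[>] 0] fun h : ℝ => h ^ 3 :=
  (hk.const_mul_left q).congr_left fun h => by ring

/-- Fourth-order accuracy of the three-stage IMQ-RBF Runge–Kutta method (case II):
`a₂₁ = c₂ = 1/3`, `a₃₁ = −5/12`, `a₃₂ = 5/4`, `c₃ = 5/6`, `b₁ = 1/10`, `b₂ = 1/2`,
`b₃ = 2/5`, shape parameters
`ε₂² = (−f f_t f_uu + 3f f_u³ + f f_u f_tu + 3f_t f_u² − f_t f_tu + f_tt f_u)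
      /(v f f_uu − 2v f_u² + v f_tu − f f_u)` and `ε₃² = −ε₂²/5` (denominator nonzero);
then the local truncation error is `O(h⁴)` as `h → 0⁺`. -/
theorem imq_rk3_fourth_order_II
    (a b : ℝ) (hab : a < b) (f : ℝ × ℝ → ℝ) (hf : ContDiff ℝ (⊤ : ℕ∞) f)
    (u : ℝ → ℝ) (hu : ContDiffOn ℝ (⊤ : ℕ∞) u (Set.Icc a b))
    (hode : ∀ s ∈ Set.Icc a b, HasDerivWithinAt u (f (s, u s)) (Set.Icc a b) s)
    (t : ℝ) (ht : t ∈ Set.Ico a b) :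
    let v := u t
    let F := f (t, v)
    let ft := pd f (1, 0) (t, v)
    let fu := pd f (0, 1) (t, v)
    let ftt := pd (pd f (1, 0)) (1, 0) (t, v)
    let ftu := pd (pd f (1, 0)) (0, 1) (t, v)
    let fuu := pd (pd f (0, 1)) (0, 1) (t, v)
    let den := v * F * fuu - 2 * v * fu ^ 2 + v * ftu - F * fu
    let eps2 := (-F * ft * fuu + 3 * F * fu ^ 3 + F * fu * ftu + 3 * ft * fu ^ 2 -
      ft * ftu + ftt * fu) / den
    let eps3 := -eps2 / 5
    den ≠ 0 →
    ∃ C > 0, ∃ h₀ > 0, ∀ h : ℝ, 0 < h → h ≤ h₀ →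
      let k1 := F
      let k2 := f (t + (1 / 3) * h,
        Real.sqrt (1 + eps2 * (1 / 3) ^ 2 * h ^ 2) * (h * (1 / 3) * k1) +
          v / Real.sqrt (1 + eps2 * (1 / 3) ^ 2 * h ^ 2))
      let k3 := f (t + (5 / 6) * h,
        Real.sqrt (1 + eps3 * (5 / 6) ^ 2 * h ^ 2) * (h * ((-5 / 12) * k1 + (5 / 4) * k2)) +
          v / Real.sqrt (1 + eps3 * (5 / 6) ^ 2 * h ^ 2))
      |(u (t + h) - u t) / h - ((1 / 10) * k1 + (1 / 2) * k2 + (2 / 5) * k3)| ≤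
        C * h ^ 4 := by
  intro v F ft fu ftt ftu fuu den eps2 eps3 hden
  obtain ⟨c₁, c₂, c₃, c₄, hT⟩ := taylor_cubic hf (t, v)
  have hE : eps2 * den = -F * ft * fuu + 3 * F * fu ^ 3 + F * fu * ftu + 3 * ft * fu ^ 2 -
      ft * ftu + ftt * fu := div_mul_cancel₀ _ hden
  change (fun p : ℝ × ℝ => f p - (F + ft * (p.1 - t) + fu * (p.2 - v) +
      ftt / 2 * (p.1 - t) ^ 2 + ftu * ((p.1 - t) * (p.2 - v)) + fuu / 2 * (p.2 - v) ^ 2 +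
      c₁ * (p.1 - t) ^ 3 + c₂ * ((p.1 - t) ^ 2 * (p.2 - v)) +
      c₃ * ((p.1 - t) * (p.2 - v) ^ 2) + c₄ * (p.2 - v) ^ 3))
      =O[𝓝 (t, v)] fun p => ‖p - (t, v)‖ ^ 4 at hT
  have hder : ∀ s ∈ Icc 0 (b - t), HasDerivWithinAt (fun h => u (t + h))
      (f (t + 1 * s, u (t + s))) (Icc 0 (b - t)) s := by
    intro s hs
    have hmaps : MapsTo (fun h => t + h) (Icc 0 (b - t)) (Icc a b) := fun x hx =>
      ⟨by linarith [ht.1, hx.1], by linarith [hx.2]⟩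
    simpa [Function.comp_def] using (hode (t + s) (hmaps hs)).comp s
      ((hasDerivWithinAt_id s _).const_add t) hmaps
  have hu5 := isBigO_solution_expansion hT (sub_pos.2 ht.2) (by simp [v]) hder rfl rfl rfl rfl
  have hs2 := isBigO_stage_expansion (k := fun _ => (1 / 3) * F) (κ₀ := (1 / 3) * F) (κ₁ := 0)
    (κ₂ := 0) (eps2 * (1 / 3) ^ 2) v ((isBigO_zero _ _).congr_left fun h => by ring)
  have hk2 := isBigO_comp_expansion hT (1 / 3) (by norm_num) le_rfl hs2
  have hs3 := isBigO_stage_expansion (eps3 * (5 / 6) ^ 2) v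
    (isBigO_affine_expansion ((-5 / 12) * F) (5 / 4) (isBigO_drop_cubic hk2))
  have hk3 := isBigO_comp_expansion hT (5 / 6) (by norm_num) le_rfl hs3
  have hk := ((isBigO_refl (fun h : ℝ => h) (𝓝[>] 0)).mul
    ((hk2.const_mul_left (1 / 2)).add (hk3.const_mul_left (2 / 5)))).congr_right
    (g₂ := fun h : ℝ => h ^ 5) fun h => by ring
  obtain ⟨C, hC, hCO⟩ := (hu5.sub hk).exists_pos
  obtain ⟨r, hr, hball⟩ := mem_nhdsGT_iff_exists_Ioo_subset.1 hCO.bound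
  rw [mem_Ioi] at hr
  refine ⟨C, hC, r / 2, half_pos hr, fun h hpos hle => ?_⟩
  have hb := hball ⟨hpos, by linarith⟩
  rw [mem_ofPred_eq, norm_pow, Real.norm_of_nonneg hpos.le, Real.norm_eq_abs] at hb
  intro k1 k2 k3
  simp only [← mul_assoc h (1 / 3) F] at hb
  change |_ - h * (1 / 2 * (k2 - _) + 2 / 5 * (k3 - _))| ≤ _ at hb
  rw [← mul_le_mul_iff_right₀ hpos]
  calc h * |(u (t + h) - u t) / h - ((1 / 10) * k1 + (1 / 2) * k2 + (2 / 5) * k3)|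
      = |(u (t + h) - v) - h * ((1 / 10) * F + (1 / 2) * k2 + (2 / 5) * k3)| := by
        rw [← abs_of_pos hpos, ← abs_mul, abs_of_pos hpos]
        congr 1
        simp only [v, k1]
        field_simp
    _ ≤ C * h ^ 5 := by
        refine le_of_eq_of_le (congrArg _ ?_) hb
        simp only [eps3]
        linear_combination (-1 / 72 * h ^ 4) * hE
    _ = h * (C * h ^ 4) := by ring
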